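/- Let μ be a Borel probability measure on Ω⁺ invariant under the shift S. Let u be a (possibly empty) prefix of ω and set x = μ(C_u). Then for every letter a ∈ A the word au belongs to L(Ω), and the d values μ(C_{1u}), μ(C_{2u}), …, μ(C_{du}) are, in some order (not necessarily respective), exactly the d numbers λ^{−(d−1+k)}·x for 0 ≤ k ≤ d−1. -/

import Mathlib

/-- The substitution σ on the alphabet A = {1, …, d}:
σ(1) = 12, σ(k) = k+1 for 2 ≤ k ≤ d−1, σ(d) = 1. Letters are literal natural numbers. -/
def sig (d : ℕ) (a : ℕ) : List ℕ :=
  if a = 1 then [1, 2] else if a = d then [1] else [a + 1]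

/-- Extension of a substitution to finite words by concatenation. -/
def applySub (f : ℕ → List ℕ) : List ℕ → List ℕ
  | [] => []
  | a :: w => f a ++ applySub f w

/-- σⁿ applied to a word. -/
def sigIter (d n : ℕ) (w : List ℕ) : List ℕ := (applySub (sig d))^[n] w

/-- The language L(Ω): the set of finite factors of the fixed point ω, i.e. of the
words σⁿ(1). -/
def Lang (d : ℕ) (u : List ℕ) : Prop := ∃ n : ℕ, u <:+: sigIter d n [1]

/-- `w` is a (finite) prefix of the infinite word `V`. -/
def PrefixOfInf (w : List ℕ) (V : ℕ → ℕ) : Prop :=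
  ∀ (i : ℕ) (h : i < w.length), w.get ⟨i, h⟩ = V i

/-- `ω` is the fixed point of σ: the unique infinite word admitting every σⁿ(1) as a
prefix. -/
def IsSigmaFixedPoint (d : ℕ) (ω : ℕ → ℕ) : Prop :=
  ∀ n : ℕ, PrefixOfInf (sigIter d n [1]) ω

/-- `u` is left-special: there are distinct letters a, b ∈ A with au, bu ∈ L(Ω). -/
def LeftSpecial (d : ℕ) (u : List ℕ) : Prop :=
  ∃ a b : ℕ, a ≠ b ∧ 1 ≤ a ∧ a ≤ d ∧ 1 ≤ b ∧ b ≤ d ∧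
    Lang d (a :: u) ∧ Lang d (b :: u)

/-- `u` is right-special: there are distinct letters a, b ∈ A with ua, ub ∈ L(Ω). -/
def RightSpecial (d : ℕ) (u : List ℕ) : Prop :=
  ∃ a b : ℕ, a ≠ b ∧ 1 ≤ a ∧ a ≤ d ∧ 1 ≤ b ∧ b ≤ d ∧
    Lang d (u ++ [a]) ∧ Lang d (u ++ [b])

/-- `u` is bispecial: both left- and right-special. -/
def Bispecial (d : ℕ) (u : List ℕ) : Prop := LeftSpecial d u ∧ RightSpecial d u

/-- The shift S on infinite words. -/
def shiftMap (V : ℕ → ℕ) : ℕ → ℕ := fun i => V (i + 1)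

/-- Ω⁺ : the closure (for the product topology, letters discrete) of the shift
orbit of ω. -/
def OmegaPlus (ω : ℕ → ℕ) : Set (ℕ → ℕ) :=
  closure {V : ℕ → ℕ | ∃ n : ℕ, V = shiftMap^[n] ω}

/-- The cylinder C_u = {V ∈ Ω⁺ : u is a prefix of V}. -/
def Cyl (ω : ℕ → ℕ) (u : List ℕ) : Set (ℕ → ℕ) :=
  {V | V ∈ OmegaPlus ω ∧ PrefixOfInf u V}

/-- Prepending a letter to an infinite word. -/
def consInf (a : ℕ) (V : ℕ → ℕ) : ℕ → ℕ :=
  fun i => match i with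
  | 0 => a
  | j + 1 => V j

/-- Extension of σ to infinite words: σ(V) = σ(V₀)σ(V₁)σ(V₂)⋯ (each σ(a) is a
nonempty word, so the n-th letter of σ(V) is the n-th letter of σ(V₀…Vₙ)). -/
def sigInf (d : ℕ) (V : ℕ → ℕ) : ℕ → ℕ :=
  fun n => (applySub (sig d) ((List.range (n + 1)).map V)).getD n 0

/-- Concatenation of a finite list of words. -/
def concatAll : List (List ℕ) → List ℕ
  | [] => []
  | w :: ws => w ++ concatAll ws

theorem eq_pow_mul_of_recurrence {d : ℕ} (hd : 1 ≤ d) {q : ℝ} (hq : 0 < q)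
    (hqd : q + q ^ d = 1) (x : ℕ → ℝ) (hx : ∀ n, 0 ≤ x n)
    (hrec : ∀ n, x n = x (n + 1) + x (n + d)) (n : ℕ) : x n = q ^ n * x 0 := by
  obtain ⟨D, rfl⟩ : ∃ D, d = D + 1 := ⟨d - 1, by omega⟩
  set z : ℕ → ℝ := fun n => x n / q ^ n with hz
  have hxz : ∀ n, x n = q ^ n * z n := fun n => by simp only [hz]; field_simp
  have hz0 : ∀ n, 0 ≤ z n := fun n => div_nonneg (hx n) (by positivity)
  have zrec : ∀ n, z n = q * z (n + 1) + q ^ (D + 1) * z (n + (D + 1)) := fun n => by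
    have h := hrec n
    rw [hxz, hxz (n + 1), hxz (n + (D + 1)), pow_add, pow_add q n (D + 1)] at h
    have hp : q ^ n ≠ 0 := by positivity
    apply mul_left_cancel₀ hp
    rw [h]; ring
  set I : ℕ → ℝ := fun n => z n + q ^ (D + 1) * ∑ i ∈ Finset.range D, z (n + 1 + i) with hI
  have Iconst : ∀ n, I n = I 0 := by
    intro n
    induction n with
    | zero => rfl
    | succ n ih =>
      rw [← ih]
      have h1 := Finset.sum_range_succ (fun i => z (n + 1 + i)) D
      have h2 := Finset.sum_range_succ' (fun i => z (n + 1 + i)) D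
      have h3 : ∑ i ∈ Finset.range D, z (n + 1 + 1 + i)
          = ∑ i ∈ Finset.range D, z (n + 1 + (i + 1)) :=
        Finset.sum_congr rfl fun i _ => by congr 1; ring
      have h4 := zrec n
      have h5 : n + (D + 1) = n + 1 + D := by ring
      simp only [hI]
      rw [h5] at h4
      rw [h3]
      simp only [add_zero] at h2
      have h6 : ∑ i ∈ Finset.range D, z (n + 1 + (i + 1))
          = ∑ i ∈ Finset.range D, z (n + 1 + i) + z (n + 1 + D) - z (n + 1) := by linarith
      rw [h6]
      linear_combination (-1 : ℝ) * h4 - z (n + 1) * hqd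
  have hbdd : BddAbove (Set.range z) := by
    refine ⟨I 0, ?_⟩
    rintro _ ⟨n, rfl⟩
    rw [← Iconst n]
    have : 0 ≤ q ^ (D + 1) * ∑ i ∈ Finset.range D, z (n + 1 + i) :=
      mul_nonneg (by positivity) (Finset.sum_nonneg fun i _ => hz0 _)
    simp only [hI]; linarith
  set M := ⨆ n, z n with hM
  have hle : ∀ n, z n ≤ M := fun n => le_ciSup hbdd n
  set W : ℝ := 1 + q ^ (D + 1) * D with hW
  have hdef : ∀ n, W * M - I 0
      = (M - z n) + q ^ (D + 1) * ∑ i ∈ Finset.range D, (M - z (n + 1 + i)) := fun n => by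
    rw [← Iconst n, Finset.sum_sub_distrib]
    rw [Finset.sum_const, Finset.card_range, nsmul_eq_mul, hW]
    ring
  have hstep : ∀ i n, M - z (n + i) ≤ q⁻¹ ^ i * (M - z n) := by
    intro i
    induction i with
    | zero => intro n; simp
    | succ i ih =>
      intro n
      have h1 : q * (M - z (n + i + 1)) ≤ M - z (n + i) := by
        have h2 := zrec (n + i)
        have h3 : 0 ≤ q ^ (D + 1) * (M - z (n + i + (D + 1))) :=
          mul_nonneg (by positivity) (sub_nonneg.2 (hle _))
        have h4 : M = q * M + q ^ (D + 1) * M := by rw [← add_mul, hqd, one_mul]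
        nlinarith
      calc M - z (n + (i + 1)) = q⁻¹ * (q * (M - z (n + i + 1))) := by
            rw [inv_mul_cancel_left₀ hq.ne', add_assoc]
        _ ≤ q⁻¹ * (q⁻¹ ^ i * (M - z n)) :=
            mul_le_mul_of_nonneg_left (h1.trans (ih n)) (by positivity)
        _ = q⁻¹ ^ (i + 1) * (M - z n) := by ring
  set K : ℝ := 1 + q ^ (D + 1) * ∑ i ∈ Finset.range D, q⁻¹ ^ (1 + i) with hK
  have hKpos : 0 < K := by
    have : 0 ≤ q ^ (D + 1) * ∑ i ∈ Finset.range D, q⁻¹ ^ (1 + i) :=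
      mul_nonneg (pow_pos hq _).le (Finset.sum_nonneg fun i _ => (pow_pos (inv_pos.2 hq) _).le)
    linarith
  have hupper : ∀ n, W * M - I 0 ≤ K * (M - z n) := fun n => by
    rw [hdef n, hK, add_mul, one_mul, mul_assoc, Finset.sum_mul]
    gcongr with i _
    rw [add_assoc]
    exact hstep (1 + i) n
  have hsup : M ≤ M - (W * M - I 0) / K := by
    refine ciSup_le fun n => ?_
    have := (div_le_iff₀' hKpos).2 (hupper n)
    linarith
  have hWM : W * M - I 0 ≤ 0 := by
    by_contra! h
    have := div_pos h hKpos
    linarith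
  have hzM : ∀ n, z n = M := fun n => by
    have h1 := hdef n
    have h2 : 0 ≤ q ^ (D + 1) * ∑ i ∈ Finset.range D, (M - z (n + 1 + i)) :=
      mul_nonneg (by positivity) (Finset.sum_nonneg fun i _ => sub_nonneg.2 (hle _))
    exact le_antisymm (hle n) (by linarith)
  rw [hxz n, hxz 0, hzM n, hzM 0]
  simp

theorem applySub_append (f : ℕ → List ℕ) (v w : List ℕ) :
    applySub f (v ++ w) = applySub f v ++ applySub f w := by
  induction v with
  | nil => rfl
  | cons a v ih => simp [applySub, ih]

theorem sigIter_succ (d n : ℕ) (w : List ℕ) :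
    sigIter d (n + 1) w = applySub (sig d) (sigIter d n w) :=
  Function.iterate_succ_apply' _ _ _

theorem sig_ne_nil (d a : ℕ) : sig d a ≠ [] := by
  unfold sig; split_ifs <;> simp

theorem sig_one (d : ℕ) : sig d 1 = [1, 2] := by simp [sig]

theorem sig_last {d : ℕ} (hd : 3 ≤ d) : sig d d = [1] := by
  rw [sig, if_neg (by omega), if_pos rfl]

theorem sig_of_ne {d a : ℕ} (h1 : a ≠ 1) (hd : a ≠ d) : sig d a = [a + 1] := by
  simp [sig, h1, hd]

/-- The last letter of `σ(a)`. -/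
def rot (d a : ℕ) : ℕ := if a = d then 1 else a + 1

theorem rot_mem {d a : ℕ} (ha : a ∈ Finset.Icc 1 d) : rot d a ∈ Finset.Icc 1 d := by
  simp only [rot, Finset.mem_Icc] at *
  split_ifs <;> omega

theorem sum_rot (d : ℕ) (f : ℕ → ℝ) :
    ∑ a ∈ Finset.Icc 1 d, f (rot d a) = ∑ a ∈ Finset.Icc 1 d, f a := by
  refine Finset.sum_nbij' (rot d) (fun b => if b = 1 then d else b - 1)
    (fun a ha => rot_mem ha) ?_ ?_ ?_ (fun _ _ => rfl)
  all_goals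
    intro a ha
    simp only [rot, Finset.mem_Icc] at *
    grind

theorem exists_equiv_rot (d : ℕ) :
    ∃ ρ : Fin d ≃ Fin d, ∀ i, (ρ i : ℕ) + 1 = rot d (i + 1) := by
  have hlt : ∀ i : Fin d, rot d (i + 1) - 1 < d := fun i => by
    have := i.2
    unfold rot; split_ifs <;> omega
  have hinj : Function.Injective fun i : Fin d => (⟨rot d (i + 1) - 1, hlt i⟩ : Fin d) := by
    intro i j hij
    have hi := i.2
    have hj := j.2
    simp only [rot, Fin.mk.injEq] at hij
    ext
    grind
  refine ⟨Equiv.ofBijective _ (Finite.injective_iff_bijective.1 hinj), fun i => ?_⟩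
  simp only [Equiv.ofBijective_apply, rot]
  grind

/-- The words over the alphabet `{1, …, d}`. -/
def IsWord (d : ℕ) (w : List ℕ) : Prop := ∀ a ∈ w, a ∈ Finset.Icc 1 d

theorem IsWord.append {d : ℕ} {v w : List ℕ} (hv : IsWord d v) (hw : IsWord d w) :
    IsWord d (v ++ w) := fun a ha => (List.mem_append.1 ha).elim (hv a) (hw a)

theorem IsWord.of_infix {d : ℕ} {v w : List ℕ} (hw : IsWord d w) (h : v <:+: w) :
    IsWord d v := fun a ha => hw a (h.subset ha)

theorem isWord_cons {d a : ℕ} {w : List ℕ} :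
    IsWord d (a :: w) ↔ a ∈ Finset.Icc 1 d ∧ IsWord d w := List.forall_mem_cons

theorem isWord_singleton {d a : ℕ} : IsWord d [a] ↔ a ∈ Finset.Icc 1 d := by
  simp [IsWord]

theorem isWord_nil (d : ℕ) : IsWord d [] := by simp [IsWord]

theorem isWord_sig {d a : ℕ} (hd : 3 ≤ d) (ha : a ∈ Finset.Icc 1 d) : IsWord d (sig d a) := by
  rw [Finset.mem_Icc] at ha
  unfold sig IsWord
  split_ifs <;> simp <;> omega

theorem IsWord.applySub {d : ℕ} (hd : 3 ≤ d) {w : List ℕ} (hw : IsWord d w) :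
    IsWord d (applySub (sig d) w) := by
  induction w with
  | nil => exact isWord_nil d
  | cons a w ih =>
    rw [isWord_cons] at hw
    exact (isWord_sig hd hw.1).append (ih hw.2)

theorem isWord_sigIter {d : ℕ} (hd : 3 ≤ d) (n : ℕ) : IsWord d (sigIter d n [1]) := by
  induction n with
  | zero => exact isWord_singleton.2 (Finset.mem_Icc.2 ⟨le_rfl, by omega⟩)
  | succ n ih => rw [sigIter_succ]; exact ih.applySub hd

theorem Lang.isWord {d : ℕ} (hd : 3 ≤ d) {w : List ℕ} (h : Lang d w) : IsWord d w := by
  obtain ⟨n, hn⟩ := h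
  exact (isWord_sigIter hd n).of_infix hn

/-- A necessary condition on two consecutive letters of a word of the language. -/
def Follows (d a b : ℕ) : Prop := b = 1 ∨ (b = a + 1 ∧ b ≤ d)

theorem isChain_applySub {d : ℕ} (hd : 3 ≤ d) {w : List ℕ} (h : w.IsChain (Follows d)) :
    (applySub (sig d) w).IsChain (Follows d) := by
  induction w with
  | nil => simp [applySub]
  | cons a w ih =>
    have hw := ih h.tail
    rw [applySub, List.isChain_append]
    refine ⟨?_, hw, ?_⟩
    · unfold sig
      split_ifs <;> simp [Follows]; omega
    · intro x hx y hy
      cases w with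
      | nil => simp [applySub] at hy
      | cons b w =>
        rw [List.isChain_cons_cons] at h
        have hab := h.1
        simp only [applySub, sig, Follows] at *
        split_ifs at * <;> simp at * <;> omega

theorem isChain_sigIter {d : ℕ} (hd : 3 ≤ d) (n : ℕ) :
    (sigIter d n [1]).IsChain (Follows d) := by
  induction n with
  | zero => simp [sigIter]
  | succ n ih => rw [sigIter_succ]; exact isChain_applySub hd ih

theorem Lang.follows {d : ℕ} (hd : 3 ≤ d) {p s : List ℕ} {a b : ℕ}
    (h : Lang d (p ++ a :: b :: s)) : Follows d a b := by
  obtain ⟨n, hn⟩ := h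
  exact (List.isChain_append_cons_cons.1 ((isChain_sigIter hd n).infix hn)).2.1

theorem head?_applySub_ne_two {d : ℕ} {w : List ℕ} (hw : IsWord d w) :
    (applySub (sig d) w).head? ≠ some 2 := by
  cases w with
  | nil => simp [applySub]
  | cons a w =>
    have := Finset.mem_Icc.1 (isWord_cons.1 hw).1
    simp only [applySub, sig]
    split_ifs <;> simp; omega

/-- A factorization of `σ(v)` whose second factor does not begin with `2` comes from a
factorization of `v`. -/
theorem exists_append_of_applySub_eq_append {d : ℕ} {v p r : List ℕ}
    (h : applySub (sig d) v = p ++ r) (hr : r.head? ≠ some 2) :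
    ∃ v₁ v₂, v = v₁ ++ v₂ ∧ applySub (sig d) v₁ = p ∧ applySub (sig d) v₂ = r := by
  induction v generalizing p with
  | nil =>
    obtain ⟨rfl, rfl⟩ := List.append_eq_nil_iff.1 h.symm
    exact ⟨[], [], rfl, rfl, rfl⟩
  | cons a v ih =>
    rcases p with _ | ⟨b, p⟩
    · exact ⟨[], a :: v, rfl, rfl, h⟩
    · have key : ∃ p', b :: p = sig d a ++ p' ∧ applySub (sig d) v = p' ++ r := by
        simp only [applySub] at h
        rcases List.append_eq_append_iff.1 h with ⟨t, ht, ht'⟩ | ⟨t, ht, ht'⟩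
        · exact ⟨t, ht, ht'⟩
        · rcases t with _ | ⟨c, t⟩
          · exact ⟨[], by simpa using ht.symm, by simpa using ht'.symm⟩
          · exfalso
            unfold sig at ht
            split_ifs at ht
            · simp only [List.cons_append, List.cons.injEq] at ht
              rcases p with _ | ⟨e, p⟩
              · simp only [List.nil_append, List.cons.injEq] at ht
                rw [ht'] at hr
                simp [← ht.2.1] at hr
              · simp at ht
            · simp at ht
            · simp at ht
      obtain ⟨p', hp, hv⟩ := key
      obtain ⟨v₁, v₂, rfl, rfl, h₂⟩ := ih hv
      exact ⟨a :: v₁, v₂, rfl, hp.symm, h₂⟩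

theorem applySub_sig_injOn {d : ℕ} {v w : List ℕ} (hv : IsWord d v) (hw : IsWord d w)
    (h : applySub (sig d) v = applySub (sig d) w) : v = w := by
  induction v generalizing w with
  | nil =>
    cases w with
    | nil => rfl
    | cons b w => simp [applySub, sig_ne_nil] at h
  | cons a v ih =>
    cases w with
    | nil => simp [applySub, sig_ne_nil] at h
    | cons b w =>
      rw [isWord_cons, Finset.mem_Icc] at hv hw
      have h2v := head?_applySub_ne_two hv.2
      have h2w := head?_applySub_ne_two hw.2
      have key : a = b ∧ applySub (sig d) v = applySub (sig d) w := by
        simp only [applySub, sig] at h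
        split_ifs at h <;> simp at h <;> grind
      rw [key.1, ih hv.2 hw.2 key.2]

theorem Lang.of_applySub_append {d : ℕ} (hd : 3 ≤ d) {w : List ℕ} (hw : IsWord d w) {b : ℕ}
    (hb : b ≠ 2) (h : Lang d (applySub (sig d) w ++ [b])) : Lang d w := by
  obtain ⟨n, p, s, h⟩ := h
  cases n with
  | zero =>
    cases w with
    | nil => exact ⟨0, List.nil_infix⟩
    | cons a w =>
      have hl := congrArg List.length h
      have := List.length_pos_iff.2 (sig_ne_nil d a)
      simp [applySub, sigIter] at hl
      omega
  | succ n =>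
    rw [sigIter_succ, List.append_assoc, List.append_assoc] at h
    have hr : (applySub (sig d) w ++ ([b] ++ s)).head? ≠ some 2 := by
      have := head?_applySub_ne_two hw
      cases hh : applySub (sig d) w with
      | nil => simpa using hb
      | cons c t => simpa [hh] using this
    obtain ⟨v₁, v₂, hv, -, h₂⟩ := exists_append_of_applySub_eq_append h.symm hr
    obtain ⟨v₃, v₄, rfl, h₃, -⟩ := exists_append_of_applySub_eq_append h₂ (by simpa using hb)
    have hinf : v₃ <:+: sigIter d n [1] := ⟨v₁, v₄, by rw [hv, List.append_assoc]⟩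
    rw [← applySub_sig_injOn ((isWord_sigIter hd n).of_infix hinf) hw h₃]
    exact ⟨n, hinf⟩

/-- A prefix of `σ(v)` is `σ(w)` or `σ(w)1`, with `w` a prefix of `v`. -/
theorem prefix_applySub {d : ℕ} {u v : List ℕ} (h : u <+: applySub (sig d) v) :
    (∃ w, w <+: v ∧ u = applySub (sig d) w) ∨
      ∃ w, w ++ [1] <+: v ∧ u = applySub (sig d) w ++ [1] := by
  induction v generalizing u with
  | nil => exact .inl ⟨[], List.nil_prefix, List.prefix_nil.1 h⟩
  | cons a v ih =>
    have key : u = [] ∨ (a = 1 ∧ u = [1]) ∨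
        ∃ u', u = sig d a ++ u' ∧ u' <+: applySub (sig d) v := by
      obtain ⟨t, ht⟩ := h
      simp only [applySub] at ht
      rcases List.append_eq_append_iff.1 ht with ⟨r, hr, hr'⟩ | ⟨r, hr, hr'⟩
      · unfold sig at hr
        split_ifs at hr with h1 h2
        · rcases u with _ | ⟨b, _ | ⟨c, u⟩⟩
          · simp
          · simp at hr; simp [h1, ← hr.1]
          · simp at hr
            obtain ⟨rfl, rfl, rfl, rfl⟩ := hr
            exact .inr (.inr ⟨[], by simp [h1, sig], List.nil_prefix⟩)
        · rcases u with _ | ⟨b, u⟩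
          · simp
          · simp at hr
            obtain ⟨rfl, rfl, rfl⟩ := hr
            exact .inr (.inr ⟨[], by rw [sig, if_neg h1, if_pos h2]; rfl, List.nil_prefix⟩)
        · rcases u with _ | ⟨b, u⟩
          · simp
          · simp at hr
            obtain ⟨rfl, rfl, rfl⟩ := hr
            exact .inr (.inr ⟨[], by simp [h1, h2, sig], List.nil_prefix⟩)
      · exact .inr (.inr ⟨r, hr, t, hr'.symm⟩)
    rcases key with rfl | ⟨rfl, rfl⟩ | ⟨u', rfl, hu'⟩
    · exact .inl ⟨[], List.nil_prefix, rfl⟩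
    · exact .inr ⟨[], by simp, rfl⟩
    · rcases ih hu' with ⟨w, hw, rfl⟩ | ⟨w, hw, rfl⟩
      · exact .inl ⟨a :: w, (List.prefix_cons_inj a).2 hw, rfl⟩
      · exact .inr ⟨a :: w, (List.prefix_cons_inj a).2 hw, by simp [applySub]⟩

theorem exists_sigIter_eq_cons (d n : ℕ) : ∃ t, sigIter d n [1] = 1 :: t ∧ n ≤ t.length := by
  induction n with
  | zero => exact ⟨[], rfl, le_rfl⟩
  | succ n ih =>
    obtain ⟨t, ht, hn⟩ := ih
    have hlen : ∀ t : List ℕ, t.length ≤ (applySub (sig d) t).length := fun t => by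
      induction t with
      | nil => simp
      | cons a t ih =>
        have := List.length_pos_iff.2 (sig_ne_nil d a)
        simp only [applySub, List.length_append, List.length_cons]
        omega
    have := hlen t
    refine ⟨2 :: applySub (sig d) t, by rw [sigIter_succ, ht]; simp [applySub, sig], ?_⟩
    simp only [List.length_cons]; omega

/-- The properties of the weights `w ↦ μ(C_w)` of a finite shift-invariant measure. -/
structure InvWeight (d : ℕ) (m : List ℕ → ℝ) : Prop where
  nonneg : ∀ w, 0 ≤ m w
  left : ∀ w, m w = ∑ a ∈ Finset.Icc 1 d, m (a :: w)
  right : ∀ w, m w = ∑ a ∈ Finset.Icc 1 d, m (w ++ [a])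
  vanish : ∀ w, ¬ Lang d w → m w = 0

open Classical in
/-- The weight of `w` for the desubstituted measure: that of the set of words where `σ(w)` is
followed by the image of a letter, i.e. by a letter different from `2`. -/
noncomputable def desub (d : ℕ) (m : List ℕ → ℝ) (w : List ℕ) : ℝ :=
  if IsWord d w then m (applySub (sig d) w) - m (applySub (sig d) w ++ [2]) else 0

theorem desub_of_isWord {d : ℕ} {m : List ℕ → ℝ} {w : List ℕ} (hw : IsWord d w) :
    desub d m w = m (applySub (sig d) w) - m (applySub (sig d) w ++ [2]) := if_pos hw

theorem desub_of_not_isWord {d : ℕ} {m : List ℕ → ℝ} {w : List ℕ} (hw : ¬ IsWord d w) :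
    desub d m w = 0 := if_neg hw

namespace InvWeight

variable {d : ℕ} {m : List ℕ → ℝ}

theorem eq_zero_of_not_follows (hd : 3 ≤ d) (hm : InvWeight d m) (p s : List ℕ) {a b : ℕ}
    (h : ¬ Follows d a b) : m (p ++ a :: b :: s) = 0 :=
  hm.vanish _ fun hl => h (hl.follows hd)

theorem append_two (hd : 3 ≤ d) (hm : InvWeight d m) (p : List ℕ) {a : ℕ} (ha : a ≠ 1) :
    m (p ++ [a, 2]) = 0 :=
  hm.eq_zero_of_not_follows hd p [] (by unfold Follows; omega)

theorem cons_of_follows (hd : 3 ≤ d) (hm : InvWeight d m) {a b : ℕ} (ha : a ∈ Finset.Icc 1 d)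
    (hb : b ≠ 1) (hab : b = a + 1) (w : List ℕ) : m (b :: w) = m (a :: b :: w) := by
  rw [hm.left (b :: w)]
  refine Finset.sum_eq_single a (fun c _ hc => ?_) (fun h => absurd ha h)
  exact hm.eq_zero_of_not_follows hd [] w (by unfold Follows; omega)

theorem sig_append (hd : 3 ≤ d) (hm : InvWeight d m) (a : ℕ) (r : List ℕ) :
    m (sig d a ++ r) = m (rot d a :: r) := by
  unfold sig rot
  split_ifs with h1 h2 h2
  · omega
  · subst h1
    exact (hm.cons_of_follows hd (Finset.mem_Icc.2 ⟨le_rfl, by omega⟩) (by omega) rfl r).symm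
  · rfl
  · rfl

theorem desub (hd : 3 ≤ d) (hm : InvWeight d m) : InvWeight d (desub d m) := by
  have h2mem : 2 ∈ Finset.Icc 1 d := Finset.mem_Icc.2 ⟨by omega, by omega⟩
  have h1mem : 1 ∈ Finset.Icc 1 d := Finset.mem_Icc.2 ⟨by omega, by omega⟩
  have hdmem : d ∈ Finset.Icc 1 d := Finset.mem_Icc.2 ⟨by omega, by omega⟩
  refine ⟨fun w => ?_, fun w => ?_, fun w => ?_, fun w hw => ?_⟩
  · by_cases hw : IsWord d w
    · rw [desub_of_isWord hw, hm.right (applySub (sig d) w), sub_nonneg]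
      exact Finset.single_le_sum (f := fun a => m (applySub (sig d) w ++ [a]))
        (fun a _ => hm.nonneg _) h2mem
    · rw [desub_of_not_isWord hw]
  · by_cases hw : IsWord d w
    · rw [desub_of_isWord hw, hm.left, hm.left (_ ++ [2]),
        ← sum_rot d fun a => m (a :: applySub (sig d) w),
        ← sum_rot d fun a => m (a :: (applySub (sig d) w ++ [2])), ← Finset.sum_sub_distrib]
      refine Finset.sum_congr rfl fun a ha => ?_
      rw [desub_of_isWord (isWord_cons.2 ⟨ha, hw⟩), applySub, List.append_assoc,
        hm.sig_append hd, hm.sig_append hd]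
    · rw [desub_of_not_isWord hw]
      exact (Finset.sum_eq_zero fun a _ =>
        desub_of_not_isWord fun h => hw (isWord_cons.1 h).2).symm
  · by_cases hw : IsWord d w
    · set W := applySub (sig d) w with hW
      have key : ∀ a ∈ Finset.Icc 1 d, _root_.desub d m (w ++ [a]) = m (W ++ [rot d a])
          + (if a = 1 then m (W ++ [1, 2]) - m (W ++ [2]) else 0)
          - (if a = d then m (W ++ [1, 2]) else 0) := by
        intro a ha
        have happ : applySub (sig d) (w ++ [a]) = W ++ sig d a := by
          rw [applySub_append]; simp [applySub, hW]
        rw [desub_of_isWord (hw.append (isWord_singleton.2 ha)), happ]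
        by_cases h1 : a = 1
        · subst h1
          have h := hm.append_two hd (W ++ [1]) (a := 2) (by omega)
          rw [if_pos rfl, if_neg (by omega), sig_one, rot, if_neg (by omega)]
          simp only [List.append_assoc, List.cons_append, List.nil_append] at h ⊢
          rw [h]; ring
        · by_cases hda : a = d
          · subst hda
            rw [if_neg h1, if_pos rfl, sig_last hd, rot, if_pos rfl]
            simp
          · rw [if_neg h1, if_neg hda, sig_of_ne h1 hda, rot, if_neg hda]
            have h := hm.append_two hd W (a := a + 1) (by rw [Finset.mem_Icc] at ha; omega)
            simp only [List.append_assoc, List.cons_append, List.nil_append] at h ⊢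
            rw [h]; ring
      rw [desub_of_isWord hw, Finset.sum_congr rfl key, Finset.sum_sub_distrib,
        Finset.sum_add_distrib, sum_rot d fun a => m (W ++ [a]), ← hm.right,
        Finset.sum_ite_eq', Finset.sum_ite_eq', if_pos h1mem, if_pos hdmem]
      ring
    · rw [desub_of_not_isWord hw]
      exact (Finset.sum_eq_zero fun a _ => desub_of_not_isWord fun h =>
        hw fun b hb => h b (List.mem_append_left _ hb)).symm
  · by_cases hw' : IsWord d w
    · rw [desub_of_isWord hw', hm.right (applySub (sig d) w), sub_eq_zero]
      refine Finset.sum_eq_single 2 (fun b _ hb => ?_) (fun h => absurd h2mem h)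
      exact hm.vanish _ fun h => hw (h.of_applySub_append hd hw' hb)
    · exact desub_of_not_isWord hw'

theorem desub_cons_append_singleton (hd : 3 ≤ d) (hm : InvWeight d m) {a c : ℕ} {w : List ℕ}
    (hw : IsWord d (a :: (w ++ [c]))) (hc : c ≠ d) :
    _root_.desub d m (a :: (w ++ [c])) = m (rot d a :: applySub (sig d) (w ++ [c])) := by
  have hcw : c ∈ Finset.Icc 1 d := hw c (by simp)
  rw [desub_of_isWord hw, applySub, List.append_assoc, hm.sig_append hd, hm.sig_append hd,
    sub_eq_self, applySub_append]
  simp only [applySub, List.append_nil]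
  by_cases h1 : c = 1
  · subst h1
    have := hm.append_two hd (rot d a :: applySub (sig d) w ++ [1]) (a := 2) (by omega)
    simpa [sig_one] using this
  · have := hm.append_two hd (rot d a :: applySub (sig d) w) (a := c + 1)
      (by rw [Finset.mem_Icc] at hcw; omega)
    simpa [sig_of_ne h1 hc] using this

theorem desub_cons_append_last (hd : 3 ≤ d) (hm : InvWeight d m) {a : ℕ} {w : List ℕ}
    (hw : IsWord d (a :: w)) :
    _root_.desub d m (a :: (w ++ [1])) + _root_.desub d m (a :: (w ++ [d]))
      = m (rot d a :: (applySub (sig d) w ++ [1])) := by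
  have hword : ∀ c ∈ Finset.Icc 1 d, IsWord d (a :: (w ++ [c])) := fun c hc =>
    hw.append (isWord_singleton.2 hc)
  rw [hm.desub_cons_append_singleton hd (hword 1 (Finset.mem_Icc.2 ⟨le_rfl, by omega⟩))
    (by omega), desub_of_isWord (hword d (Finset.mem_Icc.2 ⟨by omega, le_rfl⟩)), applySub,
    List.append_assoc, hm.sig_append hd, hm.sig_append hd, applySub_append, applySub_append]
  simp [applySub, sig_one, sig_last hd]

section Frequencies

variable {q : ℝ}

theorem iterate_desub (hd : 3 ≤ d) (hm : InvWeight d m) (n : ℕ) :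
    InvWeight d ((_root_.desub d)^[n] m) := by
  induction n with
  | zero => exact hm
  | succ n ih => rw [Function.iterate_succ_apply']; exact ih.desub hd

theorem desub_singleton (hd : 3 ≤ d) (hm : InvWeight d m) {k : ℕ} (h1 : 1 ≤ k) (hk : k < d) :
    _root_.desub d m [k] = m [k + 1] := by
  rw [desub_of_isWord (isWord_singleton.2 (Finset.mem_Icc.2 ⟨h1, hk.le⟩)), applySub,
    List.append_assoc, hm.sig_append hd, hm.sig_append hd, rot, if_neg hk.ne]
  simpa [applySub] using hm.append_two hd [] (a := k + 1) (by omega)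

theorem desub_singleton_last (hd : 3 ≤ d) (hm : InvWeight d m) :
    _root_.desub d m [d] = m [1] - m [2] := by
  rw [desub_of_isWord (isWord_singleton.2 (Finset.mem_Icc.2 ⟨by omega, le_rfl⟩)), applySub,
    sig_last hd, hm.cons_of_follows hd (a := 1) (b := 2)
      (Finset.mem_Icc.2 ⟨le_rfl, by omega⟩) (by omega) rfl]
  simp [applySub]

theorem singleton_eq (hd : 3 ≤ d) (hm : InvWeight d m) (hq : 0 < q) (hqd : q + q ^ d = 1)
    {k : ℕ} (hk : k < d) : m [k + 1] = q ^ (d - 1 + k) * m [] := by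
  set x : ℕ → ℝ := fun n => (_root_.desub d)^[n] m [1] with hx
  have hshift : ∀ k n, k < d → (_root_.desub d)^[n] m [k + 1] = x (n + k) := by
    intro k
    induction k with
    | zero => intro n _; rfl
    | succ k ih =>
      intro n hk
      rw [← (hm.iterate_desub hd n).desub_singleton hd (by omega) hk,
        ← Function.iterate_succ_apply' (_root_.desub d), ih _ (by omega)]
      congr 1; omega
  have hrec : ∀ n, x n = x (n + 1) + x (n + d) := fun n => by
    have h := (hm.iterate_desub hd n).desub_singleton_last hd
    have h1 := hshift (d - 1) (n + 1) (by omega)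
    have h2 := hshift 1 n (by omega)
    rw [Nat.sub_add_cancel (by omega), show n + 1 + (d - 1) = n + d by omega,
      Function.iterate_succ_apply'] at h1
    rw [h1, h2] at h
    simp only [hx] at h ⊢
    linarith
  have hpow := eq_pow_mul_of_recurrence (by omega) hq hqd x
    (fun n => (hm.iterate_desub hd n).nonneg _) hrec
  have hletter : ∀ k < d, m [k + 1] = q ^ k * x 0 := fun k hk => by
    rw [← hpow, ← zero_add k, ← hshift k 0 hk, zero_add]; rfl
  have hsum : m [] = (∑ k ∈ Finset.range d, q ^ k) * x 0 := by
    rw [hm.left, Finset.sum_mul, ← Finset.Ico_add_one_right_eq_Icc,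
      Finset.sum_Ico_eq_sum_range, Nat.add_sub_cancel]
    refine Finset.sum_congr rfl fun k hk => ?_
    rw [add_comm 1 k, hletter k (Finset.mem_range.1 hk)]
  have hgeom : q ^ (d - 1) * ∑ k ∈ Finset.range d, q ^ k = 1 := by
    have h1 := geom_sum_mul q d
    have h2 : q ^ d = q * q ^ (d - 1) := by rw [← pow_succ', Nat.sub_add_cancel (by omega)]
    have h3 : q ^ (d - 1) ≠ 0 := by positivity
    have h4 : (∑ k ∈ Finset.range d, q ^ k) * q ^ d = q := by
      rw [show q ^ d = -(q - 1) by linarith, mul_neg, h1]; linarith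
    apply mul_left_cancel₀ hq.ne'
    linear_combination h4 - (∑ k ∈ Finset.range d, q ^ k) * h2
  rw [hletter k hk, hsum]
  linear_combination (-(q ^ k * x 0)) * hgeom

/-- The weights of the words `1u, …, du` are, in some order, the numbers `q ^ (d - 1 + k) * m u`
for `k < d`. -/
def ExtensionLaw (d : ℕ) (q : ℝ) (m : List ℕ → ℝ) (u : List ℕ) : Prop :=
  0 < m u ∧ ∃ e : Fin d ≃ Fin d, ∀ k : Fin d,
    m (((e k : ℕ) + 1) :: u) = q ^ (d - 1 + (k : ℕ)) * m u

theorem succ_mem_Icc {d : ℕ} (i : Fin d) : (i : ℕ) + 1 ∈ Finset.Icc 1 d :=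
  Finset.mem_Icc.2 ⟨by omega, i.2⟩

theorem extensionLaw_transfer (hm : InvWeight d m) {m' : List ℕ → ℝ} (hm' : InvWeight d m')
    {u w : List ℕ} (h : ∀ a ∈ Finset.Icc 1 d, m (rot d a :: u) = m' (a :: w))
    (hw : ExtensionLaw d q m' w) : ExtensionLaw d q m u := by
  have heq : m u = m' w := by
    rw [hm.left, hm'.left, ← sum_rot d fun a => m (a :: u)]
    exact Finset.sum_congr rfl h
  obtain ⟨hpos, e, he⟩ := hw
  obtain ⟨ρ, hρ⟩ := exists_equiv_rot d
  refine ⟨heq ▸ hpos, e.trans ρ, fun k => ?_⟩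
  rw [Equiv.trans_apply, hρ, h _ (succ_mem_Icc _), he, heq]

theorem extensionLaw_nil (hd : 3 ≤ d) (hm : InvWeight d m) (hq : 0 < q) (hqd : q + q ^ d = 1)
    (hpos : 0 < m []) : ExtensionLaw d q m [] :=
  ⟨hpos, Equiv.refl _, fun k => hm.singleton_eq hd hq hqd k.2⟩

theorem extensionLaw_one (hd : 3 ≤ d) (hm : InvWeight d m) (hq : 0 < q) (hqd : q + q ^ d = 1)
    (hpos : 0 < m []) : ExtensionLaw d q m [1] := by
  have h1 : m [1] = q ^ (d - 1) * m [] := hm.singleton_eq hd hq hqd (k := 0) (by omega)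
  have h1mem : 1 ∈ Finset.Icc 1 d := Finset.mem_Icc.2 ⟨by omega, by omega⟩
  obtain ⟨ρ, hρ⟩ := exists_equiv_rot d
  refine ⟨by rw [h1]; positivity, ρ.symm, fun k => ?_⟩
  obtain ⟨i, rfl⟩ := ρ.surjective k
  rw [Equiv.symm_apply_apply]
  have hi := hρ i
  have hid := i.2
  have hfreq := hm.singleton_eq hd hq hqd hid
  by_cases hlast : (i : ℕ) + 1 = d
  · rw [rot, if_pos hlast] at hi
    have hr : m [(i : ℕ) + 1] = m [(i : ℕ) + 1, 1] := by
      rw [hm.right]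
      refine Finset.sum_eq_single 1 (fun b hb hb1 => ?_) (fun h => absurd h1mem h)
      rw [Finset.mem_Icc] at hb
      exact hm.eq_zero_of_not_follows hd [] [] (by unfold Follows; omega)
    rw [← hr, hfreq, h1, show (ρ i : ℕ) = 0 by omega, show (i : ℕ) = d - 1 by omega, pow_add]
    ring
  · rw [rot, if_neg hlast] at hi
    have hnext : m [(i : ℕ) + 1 + 1] = m [(i : ℕ) + 1, (i : ℕ) + 1 + 1] :=
      hm.cons_of_follows hd (succ_mem_Icc i) (by omega) rfl []
    have hr : m [(i : ℕ) + 1] = m [(i : ℕ) + 1, 1] + m [(i : ℕ) + 1, (i : ℕ) + 1 + 1] := by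
      rw [hm.right]
      refine Finset.sum_eq_add 1 ((i : ℕ) + 1 + 1) (by omega) (fun b hb hb1 => ?_)
        (fun h => absurd h1mem h)
        (fun h => absurd (Finset.mem_Icc.2 ⟨by omega, by omega⟩) h)
      exact hm.eq_zero_of_not_follows hd [] [] (by unfold Follows; omega)
    have hfreq' := hm.singleton_eq hd hq hqd (k := (i : ℕ) + 1) (by omega)
    rw [← hnext, hfreq, hfreq'] at hr
    have hpow : q ^ d = q ^ (d - 1) * q := by rw [← pow_succ, Nat.sub_add_cancel (by omega)]
    rw [h1, show (ρ i : ℕ) = i + 1 by omega]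
    simp only [pow_add, pow_one] at hr ⊢
    linear_combination -hr + q ^ (d - 1) * q ^ (i : ℕ) * m [] * hpow
      - q ^ (d - 1) * q ^ (i : ℕ) * m [] * hqd

theorem extensionLaw_applySub_append_one (hd : 3 ≤ d) (hm : InvWeight d m) {c : ℕ}
    {w v : List ℕ} (ih : ∀ u, u <+: v → ExtensionLaw d q (_root_.desub d m) u)
    (hw : IsWord d (w ++ [c])) (hwv : w ++ [c] <+: v)
    (h1 : c ≠ d - 1 → w ++ [c] ++ [1] <+: v) :
    ExtensionLaw d q m (applySub (sig d) (w ++ [c]) ++ [1]) := by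
  have h1mem : 1 ∈ Finset.Icc 1 d := Finset.mem_Icc.2 ⟨by omega, by omega⟩
  have hdmem : d ∈ Finset.Icc 1 d := Finset.mem_Icc.2 ⟨by omega, by omega⟩
  have hm' := hm.desub hd
  by_cases hc : c = d - 1
  · refine hm.extensionLaw_transfer hm' (fun a ha => ?_) (ih _ hwv)
    rw [← hm.desub_cons_append_last hd (isWord_cons.2 ⟨ha, hw⟩),
      hm'.right (a :: (w ++ [c]))]
    symm
    refine Finset.sum_eq_add 1 d (by omega) (fun b _ hb => ?_)
      (fun h => absurd h1mem h) (fun h => absurd hdmem h)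
    have := hm'.eq_zero_of_not_follows hd (a :: w) [] (a := c) (b := b)
      (by unfold Follows; omega)
    simpa using this
  · refine hm.extensionLaw_transfer hm' (fun a ha => ?_) (ih _ (h1 hc))
    rw [← hm.desub_cons_append_last hd (isWord_cons.2 ⟨ha, hw⟩), add_eq_left]
    have := hm'.eq_zero_of_not_follows hd (a :: w) [] (a := c) (b := d)
      (by unfold Follows; omega)
    simpa using this

theorem extensionLaw_prefix (hd : 3 ≤ d) (hq : 0 < q) (hqd : q + q ^ d = 1) (n : ℕ) :
    ∀ m, InvWeight d m → 0 < m [] → ∀ u, u <+: sigIter d n [1] → ExtensionLaw d q m u := by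
  induction n with
  | zero =>
    intro m hm hpos u hu
    rcases List.prefix_cons_iff.1 hu with rfl | ⟨t, rfl, ht⟩
    · exact hm.extensionLaw_nil hd hq hqd hpos
    · rw [List.prefix_nil.1 ht]
      exact hm.extensionLaw_one hd hq hqd hpos
  | succ n ih =>
    intro m hm hpos u hu
    have hm' := hm.desub hd
    have hpos' : 0 < _root_.desub d m [] := by
      have h2 := hm.singleton_eq hd hq hqd (k := 1) (by omega)
      rw [Nat.sub_add_cancel (by omega)] at h2
      have h3 : _root_.desub d m [] = q * m [] := by
        rw [desub_of_isWord (isWord_nil d)]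
        simp only [applySub, List.nil_append]
        rw [h2]
        linear_combination -m [] * hqd
      rw [h3]; positivity
    have ih' := ih _ hm' hpos'
    have hword := isWord_sigIter hd n
    rw [sigIter_succ] at hu
    rcases prefix_applySub hu with ⟨w, hw, rfl⟩ | ⟨w, hw, rfl⟩
    · rcases List.eq_nil_or_concat' w with rfl | ⟨w, c, rfl⟩
      · exact hm.extensionLaw_nil hd hq hqd hpos
      · have hwc := hword.of_infix hw.isInfix
        by_cases hc : c = d
        · subst hc
          rw [applySub_append]
          simp only [applySub, sig_last hd, List.append_nil]
          rcases List.eq_nil_or_concat' w with rfl | ⟨w, b, rfl⟩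
          · exact hm.extensionLaw_one hd hq hqd hpos
          · have hlang : Lang c (w ++ b :: c :: []) := ⟨n, by simpa using hw.isInfix⟩
            have hb := hlang.follows hd
            unfold Follows at hb
            exact hm.extensionLaw_applySub_append_one hd ih'
              (hwc.of_infix (List.prefix_append _ _).isInfix)
              ((List.prefix_append _ _).trans hw) (fun h => by omega)
        · exact hm.extensionLaw_transfer hm' (fun a ha =>
            (hm.desub_cons_append_singleton hd (isWord_cons.2 ⟨ha, hwc⟩) hc).symm) (ih' _ hw)
    · rcases List.eq_nil_or_concat' w with rfl | ⟨w, c, rfl⟩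
      · exact hm.extensionLaw_one hd hq hqd hpos
      · exact hm.extensionLaw_applySub_append_one hd ih'
          ((hword.of_infix hw.isInfix).of_infix (List.prefix_append _ _).isInfix)
          ((List.prefix_append _ _).trans hw) (fun _ => hw)

end Frequencies

end InvWeight

theorem PrefixOfInf.prefix_of_length_le {u v : List ℕ} {V : ℕ → ℕ} (h : PrefixOfInf u V)
    (hv : PrefixOfInf v V) (hle : u.length ≤ v.length) : u <+: v := by
  rw [List.prefix_iff_getElem]
  refine ⟨hle, fun i hi => ?_⟩
  exact (h i hi).trans (hv i (hi.trans_le hle)).symm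

theorem prefixOfInf_cons {a : ℕ} {w : List ℕ} {V : ℕ → ℕ} :
    PrefixOfInf (a :: w) V ↔ V 0 = a ∧ PrefixOfInf w (shiftMap V) := by
  constructor
  · intro h
    exact ⟨(h 0 (by simp)).symm, fun i hi => h (i + 1) (by simpa using hi)⟩
  · rintro ⟨h0, h⟩ i hi
    cases i with
    | zero => exact h0.symm
    | succ i => exact h i (by simpa using hi)

theorem prefixOfInf_append_singleton {a : ℕ} {w : List ℕ} {V : ℕ → ℕ} :
    PrefixOfInf (w ++ [a]) V ↔ PrefixOfInf w V ∧ V w.length = a := by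
  constructor
  · intro h
    refine ⟨fun i hi => ?_, ?_⟩
    · rw [← h i (by simp; omega)]
      simp [List.getElem_append_left hi]
    · rw [← h w.length (by simp)]
      simp
  · rintro ⟨h, ha⟩ i hi
    simp only [List.length_append, List.length_singleton] at hi
    rcases Nat.lt_succ_iff_lt_or_eq.1 hi with hi' | rfl
    · rw [← h i hi']
      simp [List.getElem_append_left hi']
    · simp [ha]

theorem shiftMap_iterate (n : ℕ) (V : ℕ → ℕ) (i : ℕ) : shiftMap^[n] V i = V (n + i) := by
  induction n generalizing V with
  | zero => simp
  | succ n ih =>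
    rw [Function.iterate_succ_apply, ih, shiftMap]
    congr 1; omega

theorem continuous_shiftMap : Continuous shiftMap :=
  continuous_pi fun i => continuous_apply (i + 1)

theorem shiftMap_mem_omegaPlus {ω V : ℕ → ℕ} (hV : V ∈ OmegaPlus ω) :
    shiftMap V ∈ OmegaPlus ω := by
  refine map_mem_closure continuous_shiftMap hV ?_
  rintro _ ⟨n, rfl⟩
  exact ⟨n + 1, (Function.iterate_succ_apply' _ _ _).symm⟩

theorem isClopen_setOf_prefixOfInf (w : List ℕ) : IsClopen {V | PrefixOfInf w V} := by
  induction w using List.reverseRecOn with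
  | nil => simpa [PrefixOfInf] using isClopen_univ
  | append_singleton w a ih =>
    simp only [prefixOfInf_append_singleton, Set.ofPred_and]
    exact ih.inter ((isClopen_discrete {a}).preimage (continuous_apply w.length))

theorem isClosed_cyl (ω : ℕ → ℕ) (w : List ℕ) : IsClosed (Cyl ω w) :=
  isClosed_closure.inter (isClopen_setOf_prefixOfInf w).isClosed

theorem cyl_nil (ω : ℕ → ℕ) : Cyl ω [] = OmegaPlus ω := by
  simp [Cyl, PrefixOfInf]

section FixedPoint

variable {d : ℕ} {ω : ℕ → ℕ}

theorem IsSigmaFixedPoint.exists_prefix (hω : IsSigmaFixedPoint d ω) {u : List ℕ}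
    (hu : PrefixOfInf u ω) : ∃ n, u <+: sigIter d n [1] := by
  obtain ⟨t, ht, hle⟩ := exists_sigIter_eq_cons d u.length
  exact ⟨u.length, hu.prefix_of_length_le (hω _) (by rw [ht, List.length_cons]; omega)⟩

theorem IsSigmaFixedPoint.lang (hω : IsSigmaFixedPoint d ω) {V : ℕ → ℕ}
    (hV : V ∈ OmegaPlus ω) {w : List ℕ} (hw : PrefixOfInf w V) : Lang d w := by
  obtain ⟨_, hV', n, rfl⟩ :=
    mem_closure_iff.1 hV _ (isClopen_setOf_prefixOfInf w).isOpen hw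
  have hfac : PrefixOfInf ((List.range n).map ω ++ w) ω := by
    intro i hi
    by_cases hin : i < n
    · simp [List.getElem_append_left, hin]
    · have hi' : i - n < w.length := by simp at hi; omega
      have h := hV' (i - n) hi'
      rw [shiftMap_iterate, Nat.add_sub_cancel' (by omega)] at h
      rw [← h]
      simp [List.getElem_append_right, not_lt.1 hin]
  obtain ⟨k, hk⟩ := hω.exists_prefix hfac
  exact ⟨k, (List.suffix_append _ _).isInfix.trans hk.isInfix⟩

theorem IsSigmaFixedPoint.apply_mem (hd : 3 ≤ d) (hω : IsSigmaFixedPoint d ω) {V : ℕ → ℕ}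
    (hV : V ∈ OmegaPlus ω) (i : ℕ) : V i ∈ Finset.Icc 1 d := by
  have h : PrefixOfInf ((List.range (i + 1)).map V) V := fun j hj => by simp
  exact (hω.lang hV h).isWord hd _ (List.mem_map_of_mem (by simp))

open MeasureTheory

theorem IsSigmaFixedPoint.invWeight (hd : 3 ≤ d) (hω : IsSigmaFixedPoint d ω)
    (μ : Measure (ℕ → ℕ)) [IsProbabilityMeasure μ]
    (hinv : ∀ B : Set (ℕ → ℕ), MeasurableSet B → B ⊆ OmegaPlus ω →
      μ (shiftMap ⁻¹' B ∩ OmegaPlus ω) = μ B) :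
    InvWeight d fun w => (μ (Cyl ω w)).toReal := by
  have hmeas : ∀ w, MeasurableSet (Cyl ω w) := fun w => (isClosed_cyl ω w).measurableSet
  refine ⟨fun w => ENNReal.toReal_nonneg, fun w => ?_, fun w => ?_, fun w hw => ?_⟩
  · have hunion : shiftMap ⁻¹' Cyl ω w ∩ OmegaPlus ω
        = ⋃ a ∈ Finset.Icc 1 d, Cyl ω (a :: w) := by
      ext V
      simp only [Cyl, Set.mem_inter_iff, Set.mem_preimage, Set.mem_ofPred_eq, Set.mem_iUnion,
        prefixOfInf_cons, exists_prop]
      constructor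
      · rintro ⟨⟨-, h⟩, hV⟩
        exact ⟨V 0, hω.apply_mem hd hV 0, hV, rfl, h⟩
      · rintro ⟨a, -, hV, -, h⟩
        exact ⟨⟨shiftMap_mem_omegaPlus hV, h⟩, hV⟩
    have hdisj : Set.PairwiseDisjoint (Finset.Icc 1 d : Set ℕ) fun a => Cyl ω (a :: w) := by
      intro a _ b _ hab
      refine Set.disjoint_left.2 fun V ha hb => hab ?_
      rw [← (prefixOfInf_cons.1 ha.2).1, ← (prefixOfInf_cons.1 hb.2).1]
    rw [← hinv _ (hmeas w) fun V hV => hV.1, hunion,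
      measure_biUnion_finset hdisj fun a _ => hmeas _,
      ENNReal.toReal_sum fun a _ => measure_ne_top _ _]
  · have hunion : Cyl ω w = ⋃ a ∈ Finset.Icc 1 d, Cyl ω (w ++ [a]) := by
      ext V
      simp only [Cyl, Set.mem_ofPred_eq, Set.mem_iUnion, prefixOfInf_append_singleton,
        exists_prop]
      constructor
      · rintro ⟨hV, h⟩
        exact ⟨V w.length, hω.apply_mem hd hV _, hV, h, rfl⟩
      · rintro ⟨a, -, hV, h, -⟩
        exact ⟨hV, h⟩
    have hdisj : Set.PairwiseDisjoint (Finset.Icc 1 d : Set ℕ) fun a => Cyl ω (w ++ [a]) := by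
      intro a _ b _ hab
      refine Set.disjoint_left.2 fun V ha hb => hab ?_
      rw [← (prefixOfInf_append_singleton.1 ha.2).2, ← (prefixOfInf_append_singleton.1 hb.2).2]
    conv_lhs => rw [hunion]
    rw [measure_biUnion_finset hdisj fun a _ => hmeas _,
      ENNReal.toReal_sum fun a _ => measure_ne_top _ _]
  · have hempty : Cyl ω w = ∅ :=
      Set.eq_empty_of_forall_notMem fun V hV => hw (hω.lang hV.1 hV.2)
    simp [hempty]

end FixedPoint

open MeasureTheory in
/-- Let μ be a shift-invariant Borel probability measure on Ω⁺, and let u be a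
(possibly empty) prefix of ω, x = μ(C_u). Then au ∈ L(Ω) for every letter a ∈ A, and
the d values μ(C_{1u}), …, μ(C_{du}) are, in some order, exactly the numbers
λ^{−(d−1+k)}·x for 0 ≤ k ≤ d−1, where λ > 1 satisfies λ^d = λ^{d−1} + 1. -/
theorem stmt_14 (d : ℕ) (hd : 3 ≤ d) (ω : ℕ → ℕ) (hω : IsSigmaFixedPoint d ω)
    (μ : Measure (ℕ → ℕ)) [IsProbabilityMeasure μ]
    (hμΩ : μ (OmegaPlus ω) = 1)
    (hinv : ∀ B : Set (ℕ → ℕ), MeasurableSet B → B ⊆ OmegaPlus ω →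
      μ (shiftMap ⁻¹' B ∩ OmegaPlus ω) = μ B)
    (lam : ℝ) (hlam1 : 1 < lam) (hlam : lam ^ d = lam ^ (d - 1) + 1)
    (u : List ℕ) (hu : PrefixOfInf u ω) :
    (∀ a : ℕ, 1 ≤ a → a ≤ d → Lang d (a :: u)) ∧
    ∃ e : Fin d ≃ Fin d, ∀ k : Fin d,
      (μ (Cyl ω (((e k : ℕ) + 1) :: u))).toReal =
        lam ^ (-((d - 1 + (k : ℕ) : ℕ) : ℤ)) * (μ (Cyl ω u)).toReal := by
  have hlam0 : 0 < lam := by linarith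
  have hm := hω.invWeight hd μ hinv
  have hq : 0 < lam⁻¹ := inv_pos.2 hlam0
  have hqd : lam⁻¹ + lam⁻¹ ^ d = 1 := by
    have h : lam ^ d = lam * lam ^ (d - 1) := by
      rw [← pow_succ', Nat.sub_add_cancel (by omega)]
    rw [inv_pow]
    field_simp
    rw [h] at hlam ⊢
    linear_combination (-lam) * hlam
  obtain ⟨n, hn⟩ := hω.exists_prefix hu
  obtain ⟨hpos, e, he⟩ := InvWeight.extensionLaw_prefix hd hq hqd n _ hm
    (by simp [cyl_nil, hμΩ]) u hn
  refine ⟨fun a ha1 had => ?_, e, fun k => ?_⟩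
  · by_contra hlang
    have h0 := hm.vanish _ hlang
    have hk := he (e.symm ⟨a - 1, by omega⟩)
    simp only [Equiv.apply_symm_apply, Nat.sub_add_cancel ha1, h0] at hk
    have := mul_pos (pow_pos hq (d - 1 + (e.symm ⟨a - 1, by omega⟩ : ℕ))) hpos
    exact this.ne hk
  · rw [zpow_neg, zpow_natCast, ← inv_pow]
    exact he k
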